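/- With M, N, Â, u, v, σ and W as in the context, the inner product ⟨N v, W (N v)⟩ = 2σ² − 1. In particular, writing σ = cos(θ/2), the rotation angle θ of W on the invariant plane spanned by {M u, N v} satisfies cos θ = 2σ² − 1. -/

import Mathlib

open Matrix

/-- with `MᴴM = I`, `NᴴN = I`, `Â = MᴴN`, a singular triple
`(u, v, σ)` of `Â`, and `W = (2MMᴴ − I)(2NNᴴ − I)`, the Hermitian inner product
`⟨Nv, W(Nv)⟩ = 2σ² − 1`; in particular if `σ = cos(θ/2)` then `cos θ = 2σ² − 1`. -/
theorem qsve_walk_angle (d m n : ℕ)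
    (M : Matrix (Fin d) (Fin m) ℂ) (N : Matrix (Fin d) (Fin n) ℂ)
    (hM : Mᴴ * M = 1) (hN : Nᴴ * N = 1)
    (u : Fin m → ℂ) (v : Fin n → ℂ) (σ : ℝ)
    (hu : ‖(WithLp.equiv 2 (Fin m → ℂ)).symm u‖ = 1)
    (hv : ‖(WithLp.equiv 2 (Fin n → ℂ)).symm v‖ = 1)
    (hAv : (Mᴴ * N).mulVec v = (σ : ℂ) • u)
    (hAu : (Mᴴ * N)ᴴ.mulVec u = (σ : ℂ) • v) :
    star (N.mulVec v) ⬝ᵥ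
        ((2 • (M * Mᴴ) - 1) * (2 • (N * Nᴴ) - 1)).mulVec (N.mulVec v) =
      2 * (σ : ℂ) ^ 2 - 1 ∧
    ∀ θ : ℝ, σ = Real.cos (θ / 2) → Real.cos θ = 2 * σ ^ 2 - 1 := by
  have hvv : star v ⬝ᵥ v = 1 := by
    have h := EuclideanSpace.inner_eq_star_dotProduct
      ((WithLp.equiv 2 (Fin n → ℂ)).symm v) ((WithLp.equiv 2 (Fin n → ℂ)).symm v)
    rw [inner_self_eq_norm_sq_to_K, hv] at h
    rw [dotProduct_comm]
    simpa using h.symm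
  have h1 : Nᴴ *ᵥ (N *ᵥ v) = v := by
    rw [mulVec_mulVec, hN, one_mulVec]
  have h2 : Mᴴ *ᵥ (N *ᵥ v) = (σ : ℂ) • u := by
    rw [mulVec_mulVec, hAv]
  have h3 : Nᴴ *ᵥ (M *ᵥ u) = (σ : ℂ) • v := by
    rw [← hAu, mulVec_mulVec, conjTranspose_mul, conjTranspose_conjTranspose]
  have key : ∀ x : Fin d → ℂ, star (N *ᵥ v) ⬝ᵥ x = star v ⬝ᵥ (Nᴴ *ᵥ x) := by
    intro x
    rw [star_mulVec, dotProduct_mulVec]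
  have hW1 : (2 • (N * Nᴴ) - 1) *ᵥ (N *ᵥ v) = N *ᵥ v := by
    rw [sub_mulVec, smul_mulVec, ← mulVec_mulVec, h1, one_mulVec, two_smul]
    abel
  have hW2 : (2 • (M * Mᴴ) - 1) *ᵥ (N *ᵥ v) = 2 • ((σ : ℂ) • (M *ᵥ u)) - N *ᵥ v := by
    rw [sub_mulVec, smul_mulVec, ← mulVec_mulVec, h2, one_mulVec, mulVec_smul]
  refine ⟨?_, ?_⟩
  · rw [← mulVec_mulVec, hW1, hW2, key, mulVec_sub, h1, mulVec_smul, mulVec_smul, h3,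
      dotProduct_sub, dotProduct_smul, dotProduct_smul, dotProduct_smul, hvv]
    simp only [smul_eq_mul, nsmul_eq_mul]
    push_cast
    ring
  · intro θ hθ
    rw [hθ, ← Real.cos_two_mul]
    congr 1
    ring
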